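/- Let (A,H,D) admit a ν-twisted real structure J with signs ε, ε′: π∘ν̂ = ν̄∘π for an algebra automorphism ν̂ of A with ν̄(φ) = ν∘φ∘ν⁻¹, J² = ε·id, and for all a,b ∈ A: [π(a), Jπ(b)J⁻¹] = 0, [D,π(a)] J ν̄²(π(b)) J⁻¹ = J π(b) J⁻¹ [D,π(a)], D J ν = ε′ ν J D, ν J ν = J. Let k̃ ∈ A be invertible, k = π(k̃), k′ = J k J⁻¹, and assume ν̄(k k′) = k k′. Set D_k = k′ D k′ and μ = k′ ν k⁻¹ (composition of operators), with μ̄(φ) = μ∘φ∘μ⁻¹. Then (A, H, D_k) admits J as a μ-twisted real structure with the same signs: for all a,b ∈ A, [D_k,π(a)] J μ̄²(π(b)) J⁻¹ = J π(b) J⁻¹ [D_k,π(a)], D_k J μ = ε′ μ J D_k, and μ J μ = J. -/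

import Mathlib

/-- Conjugation of a linear endomorphism by an anti-linear bijection `J`:
`φ ↦ J ∘ φ ∘ J⁻¹`, which is again a linear endomorphism. -/
noncomputable def conjAL {H : Type*} [AddCommGroup H] [Module ℂ H]
    (J : H ≃ₗ⋆[ℂ] H) (φ : Module.End ℂ H) : Module.End ℂ H where
  toFun h := J (φ (J.symm h))
  map_add' x y := by simp
  map_smul' c x := by
    simp only [LinearEquiv.map_smulₛₗ, LinearMap.map_smulₛₗ, RingHom.id_apply,
      starRingEnd_apply, star_star, LinearMap.map_smul]

section conjAL

variable {H : Type*} [AddCommGroup H] [Module ℂ H] (J : H ≃ₗ⋆[ℂ] H)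

lemma conjAL_apply (φ : Module.End ℂ H) (h : H) : conjAL J φ h = J (φ (J.symm h)) := rfl

lemma conjAL_one : conjAL J 1 = 1 := by
  ext h; simp [conjAL_apply]

lemma conjAL_mul (φ ψ : Module.End ℂ H) : conjAL J (φ * ψ) = conjAL J φ * conjAL J ψ := by
  ext h; simp [conjAL_apply]

lemma conjAL_injective : Function.Injective (conjAL J) := by
  intro φ ψ h
  ext x
  simpa [conjAL_apply] using LinearMap.congr_fun h (J x)

/-- If `ν J ν = J`, then `ν (J (ν φ ν⁻¹) J⁻¹) ν⁻¹ = J φ J⁻¹`. -/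
lemma conj_conjAL_conj (ν : H ≃ₗ[ℂ] H) (hreg : ∀ h : H, ν (J (ν h)) = J h)
    (φ : Module.End ℂ H) : ν.conj (conjAL J (ν.conj φ)) = conjAL J φ := by
  ext h
  have hsymm : ν.symm (J.symm (ν.symm h)) = J.symm h := by
    apply J.injective
    rw [← hreg]
    simp
  simp [LinearEquiv.conj_apply, conjAL_apply, hsymm, hreg]

/-- If `J² = ε`, then `J (J φ J⁻¹) = φ J`. -/
lemma apply_conjAL {ε : ℂ} (hJ2 : ∀ h : H, J (J h) = ε • h) (φ : Module.End ℂ H) (h : H) :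
    J (conjAL J φ h) = φ (J h) := by
  obtain ⟨x, rfl⟩ := J.surjective h
  simp [conjAL_apply, hJ2]

end conjAL

/-- if `(A,H,D,J,ν)` is a `ν`-twisted real spectral triple and `k̃ ∈ A`
is invertible with `k = π(k̃)`, `k′ = J k J⁻¹` and `ν̄(k k′) = k k′`, then
`(A,H,D_k = k′ D k′)` admits `J` as a `μ`-twisted real structure, `μ = k′ ν k⁻¹`,
with the same signs. -/
theorem conformal_rescaling_of_twisted_real
    {A H : Type*} [Ring A] [Algebra ℂ A] [StarRing A]
    [AddCommGroup H] [Module ℂ H]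
    (π : A →ₐ[ℂ] Module.End ℂ H) (D : Module.End ℂ H)
    (ν : H ≃ₗ[ℂ] H) (J : H ≃ₗ⋆[ℂ] H)
    (nuhat : A ≃ₐ[ℂ] A) (hcompat : ∀ a : A, π (nuhat a) = ν.conj (π a))
    (ε ε' : ℂ) (hε : ε = 1 ∨ ε = -1) (hε' : ε' = 1 ∨ ε' = -1)
    (hJ2 : ∀ h : H, J (J h) = ε • h)
    (hzero : ∀ a b : A, π a * conjAL J (π b) = conjAL J (π b) * π a)
    (hone : ∀ a b : A, (D * π a - π a * D) * conjAL J (ν.conj (ν.conj (π b)))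
        = conjAL J (π b) * (D * π a - π a * D))
    (heps : ∀ h : H, D (J (ν h)) = ε' • ν (J (D h)))
    (hreg : ∀ h : H, ν (J (ν h)) = J h)
    (kt : Aˣ)
    (k' Dk μ μinv : Module.End ℂ H)
    (hk' : k' = conjAL J (π (kt : A)))
    (hkk' : ν.conj (π (kt : A) * k') = π (kt : A) * k')
    (hDk : Dk = k' * D * k')
    (hμ : μ = k' * ν.toLinearMap * π (↑kt⁻¹ : A))
    (hμinv : μinv = π (kt : A) * ν.symm.toLinearMap * conjAL J (π (↑kt⁻¹ : A))) :
    (∀ a b : A, (Dk * π a - π a * Dk) * conjAL J (μ * (μ * π b * μinv) * μinv)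
        = conjAL J (π b) * (Dk * π a - π a * Dk)) ∧
    (∀ h : H, Dk (J (μ h)) = ε' • μ (J (Dk h))) ∧
    (∀ h : H, μ (J (μ h)) = J h) := by
  have hKKi : π (kt : A) * π (↑kt⁻¹ : A) = 1 := by rw [← map_mul]; simp
  have hKiK : π (↑kt⁻¹ : A) * π (kt : A) = 1 := by rw [← map_mul]; simp
  have hJk (h : H) : J (k' h) = π (kt : A) (J h) := hk' ▸ apply_conjAL J hJ2 _ h
  have hkJ (h : H) : k' (J h) = J (π (kt : A) h) := by simp [hk', conjAL_apply]
  have hKiK' (h : H) : π (↑kt⁻¹ : A) (π (kt : A) h) = h := LinearMap.congr_fun hKiK h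
  have hKKi' (h : H) : π (kt : A) (π (↑kt⁻¹ : A) h) = h := LinearMap.congr_fun hKKi h
  have hkcomm : π (kt : A) * k' = k' * π (kt : A) := hk' ▸ hzero _ _
  refine ⟨fun a b => ?_, fun h => ?_, fun h => ?_⟩
  · let C : A →* Module.End ℂ H :=
      { toFun := fun x => conjAL J (π x)
        map_one' := by rw [map_one, conjAL_one]
        map_mul' := fun x y => by rw [map_mul, conjAL_mul] }
    have hCdef (x : A) : conjAL J (π x) = C x := rfl
    simp only [← hcompat, hCdef] at hone hzero hk' hμinv ⊢
    have hCKKi : C kt * C ↑kt⁻¹ = 1 := by rw [← map_mul]; simp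
    have hμconj (x : A) : μ * π x * μinv = π (nuhat (↑kt⁻¹ * x * kt)) := by
      have h1 : μ * π x * μinv = C kt * π (nuhat (↑kt⁻¹ * x * kt)) * C ↑kt⁻¹ := by
        rw [hμ, hμinv, hk', hcompat]
        ext h
        simp [LinearEquiv.conj_apply]
      rw [h1, ← hzero, mul_assoc, hCKKi, mul_one]
    set p : A := nuhat.symm kt with hp
    set pinv : A := nuhat.symm ↑kt⁻¹ with hpinv
    set q : A := nuhat.symm p with hq
    have hpp : pinv * p = 1 := by rw [hp, hpinv, ← map_mul]; simp
    have hnp : nuhat p = kt := by simp [hp]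
    have hnpinv : nuhat pinv = ↑kt⁻¹ := by simp [hpinv]
    have hnq : nuhat q = p := by simp [hq]
    have hCp : ν.conj k' = C p := by
      rw [hk', ← hCdef, ← hCdef, ← hnp, hcompat, conj_conjAL_conj J ν hreg]
    -- `p k⁻¹` is carried by `J` into `π(A)`, hence is central in `π(A)`
    have hCs : C (p * ↑kt⁻¹) = π (nuhat ↑kt⁻¹ * kt) := by
      have h1 : π (nuhat kt) * C p = π (kt : A) * C kt := by
        rw [← hCp, hcompat, ← hk', ← hkk']
        ext h
        simp [LinearEquiv.conj_apply]
      have h2 : π (nuhat ↑kt⁻¹) * π (nuhat kt) = 1 := by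
        rw [← map_mul, ← map_mul]; simp
      calc C (p * ↑kt⁻¹) = (π (nuhat ↑kt⁻¹) * π (nuhat kt)) * C p * C ↑kt⁻¹ := by
            rw [h2, one_mul, map_mul]
        _ = π (nuhat ↑kt⁻¹) * (π (kt : A) * C kt) * C ↑kt⁻¹ := by rw [mul_assoc _ _ (C p), h1]
        _ = π (nuhat ↑kt⁻¹) * π (kt : A) * (C kt * C ↑kt⁻¹) := by simp only [mul_assoc]
        _ = _ := by rw [hCKKi, mul_one, map_mul]
    have hs (x : A) : π (p * ↑kt⁻¹) * π x = π x * π (p * ↑kt⁻¹) := by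
      apply conjAL_injective J
      rw [conjAL_mul, conjAL_mul, hCdef, hCdef, hCs, hzero]
    have ht (x : A) : π (q * pinv) * π x = π x * π (q * pinv) := by
      apply ν.conj.injective
      have h1 : nuhat (q * pinv) = p * ↑kt⁻¹ := by rw [map_mul, hnq, hnpinv]
      rw [← map_mul π, ← map_mul π, ← hcompat, ← hcompat, map_mul nuhat (q * pinv),
        map_mul nuhat x, h1, map_mul π (p * ↑kt⁻¹), map_mul π (nuhat x), hs]
    have hkey : C (kt * (q * pinv * ↑kt⁻¹ * b * kt * p)) = C (b * kt * q) := by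
      rw [← hCdef, ← hCdef]
      congr 1
      have hq' : q = q * pinv * p := by rw [mul_assoc, hpp, mul_one]
      calc π (kt * (q * pinv * ↑kt⁻¹ * b * kt * p))
          = π kt * π (q * pinv) * π (↑kt⁻¹ * b * kt * p) := by simp only [map_mul, mul_assoc]
        _ = π (q * pinv) * (π kt * π (↑kt⁻¹ * b * kt * p)) := by rw [← ht, mul_assoc]
        _ = π (q * pinv) * π (b * kt * p) := by
            rw [← map_mul π (kt : A)]; simp only [mul_assoc, Units.mul_inv_cancel_left]
        _ = π (q * pinv) * (π (b * kt) * π p) := by rw [map_mul π (b * kt)]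
        _ = π (b * kt) * π (q * pinv) * π p := by rw [← mul_assoc, ht]
        _ = π (b * kt * q) := by
            rw [← map_mul π, ← map_mul π, mul_assoc, ← hq']
    have hcomm : Dk * π a - π a * Dk = C kt * (D * π a - π a * D) * C kt := by
      rw [hDk, hk', mul_sub, sub_mul]
      congr 1
      · simp only [mul_assoc, hzero]
      · simp only [← mul_assoc, hzero]
    have hq2 : nuhat (nuhat q) = kt := by rw [hnq, hnp]
    have hb2 : (kt : A) * nuhat (↑kt⁻¹ * nuhat (↑kt⁻¹ * b * kt) * kt)
        = nuhat (nuhat (q * pinv * ↑kt⁻¹ * b * kt * p)) := by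
      simp only [map_mul, hnq, hnp, hnpinv, mul_assoc]
    rw [hμconj, hμconj, hCdef, hcomm, mul_assoc, ← map_mul, hb2, mul_assoc, hone, ← mul_assoc,
      ← map_mul, hkey]
    conv_rhs => rw [mul_assoc (C kt), ← hq2, hone, hq2]
    simp only [map_mul, mul_assoc]
  · have hνkk (x : H) : ν (π (kt : A) (k' x)) = π (kt : A) (k' (ν x)) := by
      simpa [LinearEquiv.conj_apply] using LinearMap.congr_fun hkk' (ν x)
    have hcomm (x : H) : π (kt : A) (k' x) = k' (π (kt : A) x) := LinearMap.congr_fun hkcomm x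
    simp only [hDk, hμ, Module.End.mul_apply, LinearEquiv.coe_coe]
    rw [hkJ, ← hνkk, hcomm, hKKi', heps, map_smul, hJk, hKiK']
  · simp only [hμ, Module.End.mul_apply, LinearEquiv.coe_coe]
    rw [hJk, hKiK', hreg, hkJ, hKKi']
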